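/- Fix ε ≥ 0. Suppose Θ is convex and ℓ(θ, z) is convex in θ for every z ∈ 𝒵, and that all of the following hold: c is lower semicontinuous on 𝒵 × 𝒵; ℓ(θ, ·) is upper semicontinuous and P̂-integrable for every θ ∈ Θ; ∃ ẑ₀ ∈ 𝒵, C < ∞ with ∫ c(z, ẑ₀) dP̂(z) ≤ C; ∃ a metric d on 𝒵 with compact sublevel sets and p ∈ ℕ with c ≥ d^p on 𝒵 × 𝒵; ℓ(·, z) is lower semicontinuous on Θ for every z; for every Q ∈ B_ε(P̂) and θ̄ ∈ Θ, the negative parts {−min{0, ℓ(θ, ·)} : θ ∈ U} are uniformly Q-integrable for some neighborhood U of θ̄; ∃ Q ∈ B_ε(P̂) with θ ↦ ∫ ℓ(θ, z) dQ(z) inf-compact on Θ; for every θ ∈ Θ, ∃ g > 0, ẑ₀ ∈ 𝒵, r ∈ (0, p) with ℓ(θ, z) ≤ g(1 + d(z, ẑ₀)^r) for all z ∈ 𝒵; ∃ θ ∈ Θ with sup_{Q ∈ B_ε(P̂)} ∫ ℓ(θ, z) dQ(z) < ∞; and ∃ Q ∈ B_ε(P̂) with inf_{θ ∈ Θ} ∫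 ℓ(θ, z) dQ(z) > −∞. Then inf_{θ ∈ Θ} sup_{Q ∈ B_ε(P̂)} ∫ ℓ(θ, z) dQ(z) = sup_{Q ∈ B_ε(P̂)} inf_{θ ∈ Θ} ∫ ℓ(θ, z) dQ(z), and both the infimum over θ and the supremum over Q are attained. -/

import Mathlib

open MeasureTheory ENNReal Set Filter Topology

noncomputable section

/-- The set of couplings of two measures. -/
def couplings {α : Type*} [MeasurableSpace α] (Q P : Measure α) : Set (Measure (α × α)) :=
  {π | π.map Prod.fst = Q ∧ π.map Prod.snd = P}

/-- The optimal transport discrepancy `d_c(Q, P) = inf_π ∫ c dπ`. -/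
def OTDiscrepancy {α : Type*} [MeasurableSpace α] (c : α → α → ℝ≥0∞) (Q P : Measure α) :
    ℝ≥0∞ :=
  ⨅ π ∈ couplings Q P, ∫⁻ p, c p.1 p.2 ∂π

/-- The optimal transport ambiguity set `B_ε(P) = {Q : d_c(Q, P) ≤ ε}`. -/
def ambiguitySet {α : Type*} [MeasurableSpace α] (c : α → α → ℝ≥0∞)
    (P : ProbabilityMeasure α) (ε : ℝ) : Set (ProbabilityMeasure α) :=
  {Q | OTDiscrepancy c Q.toMeasure P.toMeasure ≤ ENNReal.ofReal ε}

/-- The `[0,∞]`-valued positive part of an extended real number. -/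
def erealPos (x : EReal) : ℝ≥0∞ := if x = ⊤ then ⊤ else ENNReal.ofReal x.toReal

/-- The `(−∞,∞]`-valued integral of a `(−∞,∞]`-valued function. -/
def eint {α : Type*} [MeasurableSpace α] (μ : Measure α) (f : α → EReal) : EReal :=
  ((∫⁻ a, erealPos (f a) ∂μ : ℝ≥0∞) : EReal) - ((∫⁻ a, erealPos (-(f a)) ∂μ : ℝ≥0∞) : EReal)

/-- A family of `[0,∞]`-valued functions is uniformly `μ`-integrable. -/
def UnifIntegrableENN {α ι : Type*} [MeasurableSpace α] (μ : Measure α)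
    (F : ι → α → ℝ≥0∞) : Prop :=
  ∀ δ : ℝ, 0 < δ → ∃ K : ℝ, ∀ i : ι,
    ∫⁻ a in {a | ENNReal.ofReal K ≤ F i a}, F i a ∂μ ≤ ENNReal.ofReal δ

/-- A minimax alternative for functions that are convex in the first variable and affine and upper
semicontinuous in the second variable, which ranges over a compact set. -/
theorem exists_forall_le_of_forall_exists_lt {E Y : Type*} [AddCommGroup E] [Module ℝ E]
    [TopologicalSpace Y] {X : Set E} (hX : Convex ℝ X) {B : Set Y} (hB : IsCompact B)
    (hBne : B.Nonempty) (F : E → Y → ℝ) (hconv : ∀ y ∈ B, ConvexOn ℝ X (fun x => F x y))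
    (husc : ∀ x ∈ X, UpperSemicontinuousOn (F x) B)
    (haff : ∀ y₁ ∈ B, ∀ y₂ ∈ B, ∀ a b : ℝ, 0 ≤ a → 0 ≤ b → a + b = 1 →
      ∃ y ∈ B, ∀ x ∈ X, F x y = a * F x y₁ + b * F x y₂)
    (s : ℝ) (h : ∀ y ∈ B, ∃ x ∈ X, F x y < s) : ∃ x ∈ X, ∀ y ∈ B, F x y ≤ s := by
  classical
  obtain ⟨u, hu⟩ : ∃ u : Finset X, ∀ y ∈ B, ∃ i ∈ u, F i y < s := by
    refine (UpperSemicontinuousOn.inter_biInter_preimage_Ici_eq_empty_iff_exists_finset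
      (f := F) (I := X) (s := B) (c := s) hB husc).1 ?_
    rw [Set.eq_empty_iff_forall_notMem]
    rintro y ⟨hy, hy'⟩
    obtain ⟨x, hx, hlt⟩ := h y hy
    exact absurd (mem_iInter₂.1 hy' x hx) (not_le.2 hlt)
  obtain ⟨y₀, hy₀⟩ := hBne
  let φ : Y → (u → ℝ) := fun y i => F i.1 y
  have hC : Convex ℝ (φ '' B) := by
    rintro _ ⟨y₁, h₁, rfl⟩ _ ⟨y₂, h₂, rfl⟩ a b ha hb hab
    obtain ⟨y, hy, hyx⟩ := haff y₁ h₁ y₂ h₂ a b ha hb hab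
    exact ⟨y, hy, by ext i; simp [φ, hyx i.1 i.1.2]⟩
  have hU : Convex ℝ (univ.pi fun _ : u => Ioi s) := convex_pi fun _ _ => convex_Ioi s
  have hUo : IsOpen (univ.pi fun _ : u => Ioi s) := isOpen_set_pi finite_univ fun _ _ => isOpen_Ioi
  have hdisj : Disjoint (univ.pi fun _ : u => Ioi s) (φ '' B) := by
    rw [Set.disjoint_left]
    rintro _ hv ⟨y, hy, rfl⟩
    obtain ⟨i, hi, hlt⟩ := hu y hy
    exact absurd (hv ⟨i, hi⟩ (mem_univ _)) (not_lt.2 hlt.le)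
  obtain ⟨f, r, hf₁, hf₂⟩ := geometric_hahn_banach_open hU hUo hC hdisj
  let w : u → ℝ := fun i => -f (Pi.single i 1)
  have hfw : ∀ v : u → ℝ, f v = -∑ i, v i * w i := by
    intro v
    conv_lhs => rw [pi_eq_sum_univ' v]
    simp only [map_sum, w, mul_neg, Finset.sum_neg_distrib, neg_neg]
    refine Finset.sum_congr rfl fun i _ => ?_
    rw [map_smul, smul_eq_mul]
  have hw : ∀ i, 0 ≤ w i := by
    intro i
    by_contra! hneg
    have hmem : ∀ t : ℝ, 0 ≤ t →
        ((fun _ => s + 1) + t • Pi.single i 1 : u → ℝ) ∈ univ.pi fun _ : u => Ioi s := by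
      intro t ht j _
      have : 0 ≤ t * (Pi.single i 1 : u → ℝ) j :=
        mul_nonneg ht (by rw [Pi.single_apply]; split_ifs <;> norm_num)
      simp only [Pi.add_apply, Pi.smul_apply, smul_eq_mul, mem_Ioi]
      linarith
    set q := f (fun _ => s + 1)
    have hpos : 0 < f (Pi.single i 1) := by simpa [w] using hneg
    have h0 : q < r := by simpa [q] using hf₁ _ (hmem 0 le_rfl)
    have h1 := hf₁ _ (hmem ((r - q) / f (Pi.single i 1)) (by positivity [sub_pos.2 h0]))
    rw [map_add, map_smul, smul_eq_mul, div_mul_cancel₀ _ hpos.ne'] at h1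
    simp [q] at h1
  have hlim : ∀ y ∈ B, ∑ i, F i.1 y * w i ≤ s * ∑ i, w i := by
    intro y hy
    refine le_of_forall_pos_le_add fun η hη => ?_
    have hle : ∀ τ : ℝ, 0 < τ → ∑ i, F i.1 y * w i ≤ (s + τ) * ∑ i, w i := by
      intro τ hτ
      have h1 := hf₁ (fun _ => s + τ) (fun _ _ => by simp [hτ])
      have h2 := hf₂ _ (mem_image_of_mem φ hy)
      rw [hfw] at h1 h2
      rw [Finset.mul_sum]
      simp only [φ] at h2
      linarith
    have hS : 0 ≤ ∑ i, w i := Finset.sum_nonneg fun i _ => hw i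
    have := hle (η / (∑ i, w i + 1)) (by positivity)
    have h3 : η / (∑ i, w i + 1) * ∑ i, w i ≤ η := by
      rw [div_mul_eq_mul_div, div_le_iff₀ (by positivity)]
      nlinarith
    nlinarith
  have hS : 0 < ∑ i, w i := by
    refine lt_of_le_of_ne (Finset.sum_nonneg fun i _ => hw i) fun h0 => ?_
    have hw0 : ∀ i, w i = 0 := fun i =>
      (Finset.sum_eq_zero_iff_of_nonneg fun i _ => hw i).1 h0.symm i (Finset.mem_univ i)
    have h1 := hf₁ (fun _ => s + 1) (fun _ _ => by simp)
    have h2 := hf₂ _ (mem_image_of_mem φ hy₀)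
    rw [hfw] at h1 h2
    simp [hw0] at h1 h2
    linarith
  set S := ∑ i, w i
  have hsum : ∑ i, w i / S = 1 := by rw [← Finset.sum_div, div_self hS.ne']
  refine ⟨∑ i, (w i / S) • (i.1 : E), hX.sum_mem (fun i _ => div_nonneg (hw i) hS.le) hsum
    fun i _ => i.1.2, fun y hy => ?_⟩
  refine ((hconv y hy).map_sum_le (fun i _ => div_nonneg (hw i) hS.le) hsum
    fun i _ => i.1.2).trans ?_
  have : ∑ i, (w i / S) • F (i.1 : E) y = (∑ i, F i.1 y * w i) / S := by
    rw [Finset.sum_div]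
    exact Finset.sum_congr rfl fun i _ => by rw [smul_eq_mul]; ring
  rw [this, div_le_iff₀ hS]
  exact hlim y hy

/-- The integral of a lower semicontinuous `[0,∞]`-valued function is lower semicontinuous with
respect to weak convergence. -/
theorem lowerSemicontinuous_lintegral {Ω : Type*} [TopologicalSpace Ω]
    [TopologicalSpace.PseudoMetrizableSpace Ω] [SecondCountableTopology Ω] [MeasurableSpace Ω]
    [BorelSpace Ω] {f : Ω → ℝ≥0∞} (hf : LowerSemicontinuous f) :
    LowerSemicontinuous fun Q : ProbabilityMeasure Ω => ∫⁻ z, f z ∂Q.toMeasure := by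
  have htrunc : ∀ n : ℕ, LowerSemicontinuous
      fun Q : ProbabilityMeasure Ω => ∫⁻ z, min (f z) n ∂Q.toMeasure := by
    intro n
    have hne : ∀ z, min (f z) n ≠ ⊤ := fun z => ne_top_of_le_ne_top (by simp) (min_le_right _ _)
    have hlsc : LowerSemicontinuous fun z => min (f z) n :=
      hf.inf lowerSemicontinuous_const
    have heq : ∀ Q : ProbabilityMeasure Ω, ∫⁻ z, min (f z) n ∂Q.toMeasure =
        ∫⁻ t in Ioi (0 : ℝ), Q.toMeasure {z | t < (min (f z) n).toReal} := by
      intro Q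
      rw [← lintegral_eq_lintegral_meas_lt _ (ae_of_all _ fun z => ENNReal.toReal_nonneg)
        (hlsc.measurable.ennreal_toReal.aemeasurable)]
      simp_rw [ENNReal.ofReal_toReal (hne _)]
    rw [lowerSemicontinuous_iff_le_liminf]
    intro Q
    simp_rw [heq]
    refine le_trans (lintegral_mono_ae ?_) (lintegral_liminf_le fun Q' => ?_)
    · filter_upwards [ae_restrict_mem measurableSet_Ioi] with t ht
      refine ProbabilityMeasure.le_liminf_measure_open_of_tendsto tendsto_id ?_
      have : {z | t < (min (f z) n).toReal} =
          (fun z => min (f z) n) ⁻¹' Ioi (ENNReal.ofReal t) := by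
        ext z
        exact (ENNReal.ofReal_lt_iff_lt_toReal (le_of_lt ht) (hne z)).symm
      rw [this]
      exact hlsc.isOpen_preimage _
    · exact Antitone.measurable fun s t hst => measure_mono fun z hz => lt_of_le_of_lt hst hz
  have hsup : (fun Q : ProbabilityMeasure Ω => ∫⁻ z, f z ∂Q.toMeasure) =
      fun Q => ⨆ n : ℕ, ∫⁻ z, min (f z) n ∂Q.toMeasure := by
    ext Q
    rw [← lintegral_iSup (fun n => hf.measurable.min measurable_const)
      (fun m n hmn z => min_le_min le_rfl (by exact_mod_cast hmn))]
    congr with z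
    rw [← inf_iSup_eq, ENNReal.iSup_natCast]
    simp
  rw [hsup]
  exact lowerSemicontinuous_iSup htrunc

/-- A moment bound for a lower semicontinuous function with relatively compact sublevel sets defines
a weakly compact set of probability measures. -/
theorem isCompact_setOf_lintegral_le {Ω : Type*} [TopologicalSpace Ω]
    [TopologicalSpace.MetrizableSpace Ω] [SecondCountableTopology Ω] [MeasurableSpace Ω]
    [BorelSpace Ω] {V : Ω → ℝ≥0∞} (hV : LowerSemicontinuous V)
    (hcpt : ∀ R : ℝ≥0∞, R ≠ ⊤ → ∃ K, IsCompact K ∧ {z | V z < R} ⊆ K) {M : ℝ≥0∞} (hM : M ≠ ⊤) :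
    IsCompact {Q : ProbabilityMeasure Ω | ∫⁻ z, V z ∂Q.toMeasure ≤ M} := by
  have hclosed : IsClosed {Q : ProbabilityMeasure Ω | ∫⁻ z, V z ∂Q.toMeasure ≤ M} :=
    (lowerSemicontinuous_lintegral hV).isClosed_preimage M
  rw [← hclosed.closure_eq]
  refine isCompact_closure_of_isTightMeasureSet ?_
  rw [isTightMeasureSet_iff_exists_isCompact_measure_compl_le]
  intro η hη
  rcases eq_or_ne η ⊤ with rfl | hη'
  · exact ⟨∅, isCompact_empty, fun _ _ => le_top⟩
  obtain ⟨K, hK, hsub⟩ := hcpt ((M + 1) / η) (ENNReal.div_ne_top (by finiteness) hη.ne')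
  refine ⟨K, hK, ?_⟩
  rintro _ ⟨Q, hQ, rfl⟩
  have hR0 : (M + 1) / η ≠ 0 := ENNReal.div_ne_zero.2 ⟨by simp, hη'⟩
  have hRt : (M + 1) / η ≠ ⊤ := ENNReal.div_ne_top (by finiteness) hη.ne'
  calc Q.toMeasure Kᶜ ≤ Q.toMeasure {z | (M + 1) / η ≤ V z} :=
        measure_mono fun z hz => by
          by_contra hlt
          exact hz (hsub (show V z < _ from not_le.1 hlt))
    _ ≤ (∫⁻ z, V z ∂Q.toMeasure) / ((M + 1) / η) :=
        meas_ge_le_lintegral_div hV.measurable.aemeasurable hR0 hRt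
    _ ≤ (M + 1) / ((M + 1) / η) := by gcongr; exact le_trans hQ le_self_add
    _ = η := by
        rw [ENNReal.div_div_cancel] <;> finiteness

/-- Probability couplings with second marginal `P` and transportation cost at most `e`. -/
def costCouplings {α : Type*} [MeasurableSpace α] (c : α → α → ℝ≥0∞)
    (P : ProbabilityMeasure α) (e : ℝ≥0∞) : Set (ProbabilityMeasure (α × α)) :=
  {π | π.toMeasure.map Prod.snd = P.toMeasure ∧ ∫⁻ q, c q.1 q.2 ∂π.toMeasure ≤ e}

theorem lintegral_fst_le_of_mem_costCouplings {α : Type*} [MeasurableSpace α]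
    {c : α → α → ℝ≥0∞} (hc : Measurable fun q : α × α => c q.1 q.2) {P : ProbabilityMeasure α}
    {e : ℝ≥0∞} {W : α → ℝ≥0∞} (hW : Measurable W) {A : ℝ≥0∞}
    (hWc : ∀ x y, W x ≤ A * (c x y + W y)) {π : ProbabilityMeasure (α × α)}
    (hπ : π ∈ costCouplings c P e) :
    ∫⁻ q, W q.1 ∂π.toMeasure ≤ A * (e + ∫⁻ z, W z ∂P.toMeasure) := by
  have hsnd : ∫⁻ q, W q.2 ∂π.toMeasure = ∫⁻ z, W z ∂P.toMeasure := by
    rw [← hπ.1, lintegral_map hW measurable_snd]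
  calc ∫⁻ q, W q.1 ∂π.toMeasure ≤ ∫⁻ q, A * (c q.1 q.2 + W q.2) ∂π.toMeasure :=
        lintegral_mono fun q => hWc q.1 q.2
    _ = A * (∫⁻ q, c q.1 q.2 ∂π.toMeasure + ∫⁻ q, W q.2 ∂π.toMeasure) := by
        have hW' : Measurable fun q : α × α => W q.2 := hW.comp measurable_snd
        rw [lintegral_const_mul _ (by fun_prop), lintegral_add_left hc]
    _ ≤ A * (e + ∫⁻ z, W z ∂P.toMeasure) := by rw [hsnd]; gcongr; exact hπ.2

theorem isCompact_costCouplings {α : Type*} [TopologicalSpace α]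
    [TopologicalSpace.MetrizableSpace α] [SecondCountableTopology α] [MeasurableSpace α]
    [BorelSpace α] {c : α → α → ℝ≥0∞} (hc : LowerSemicontinuous fun q : α × α => c q.1 q.2)
    {P : ProbabilityMeasure α} {e : ℝ≥0∞} (he : e ≠ ⊤) {W : α → ℝ≥0∞}
    (hWcpt : ∀ R : ℝ≥0∞, R ≠ ⊤ → IsCompact {z | W z ≤ R}) (hW : LowerSemicontinuous W)
    {A : ℝ≥0∞} (hA : A ≠ ⊤) (hWc : ∀ x y, W x ≤ A * (c x y + W y))
    (hWP : ∫⁻ z, W z ∂P.toMeasure ≠ ⊤) : IsCompact (costCouplings c P e) := by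
  set M := A * (e + ∫⁻ z, W z ∂P.toMeasure) + ∫⁻ z, W z ∂P.toMeasure with hMdef
  have hM : M ≠ ⊤ := by finiteness
  have hV : LowerSemicontinuous fun q : α × α => W q.1 + W q.2 :=
    (hW.comp continuous_fst).add (hW.comp continuous_snd)
  have hcpt : IsCompact {π : ProbabilityMeasure (α × α) |
      ∫⁻ q, (W q.1 + W q.2) ∂π.toMeasure ≤ M} := by
    refine isCompact_setOf_lintegral_le hV (fun R hR => ⟨_, (hWcpt R hR).prod (hWcpt R hR), ?_⟩) hM
    intro q hq
    have hq' : W q.1 + W q.2 < R := hq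
    exact ⟨show W q.1 ≤ R from le_self_add.trans hq'.le,
      show W q.2 ≤ R from le_add_self.trans hq'.le⟩
  refine hcpt.of_isClosed_subset ?_ fun π hπ => ?_
  · have h1 : IsClosed {π : ProbabilityMeasure (α × α) |
        π.map continuous_snd.measurable.aemeasurable = P} :=
      isClosed_singleton.preimage (ProbabilityMeasure.continuous_map continuous_snd)
    have h2 : IsClosed {π : ProbabilityMeasure (α × α) |
        ∫⁻ q, c q.1 q.2 ∂π.toMeasure ≤ e} :=
      (lowerSemicontinuous_lintegral hc).isClosed_preimage e
    convert! h1.inter h2 using 1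
    ext π
    refine and_congr_left fun _ => ?_
    rw [← ProbabilityMeasure.toMeasure_map π continuous_snd.measurable.aemeasurable]
    exact ProbabilityMeasure.toMeasure_injective.eq_iff
  · have hsnd : ∫⁻ q, W q.2 ∂π.toMeasure = ∫⁻ z, W z ∂P.toMeasure := by
      rw [← hπ.1, lintegral_map hW.measurable measurable_snd]
    change ∫⁻ q, (W q.1 + W q.2) ∂π.toMeasure ≤ M
    have hWfst : Measurable fun q : α × α => W q.1 := hW.measurable.comp measurable_fst
    rw [lintegral_add_left hWfst, hsnd, hMdef]
    gcongr
    exact lintegral_fst_le_of_mem_costCouplings hc.measurable hW.measurable hWc hπ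

/-- An element of the ambiguity set is the first marginal of a coupling of almost optimal cost. -/
theorem exists_mem_costCouplings {α : Type*} [MeasurableSpace α] {c : α → α → ℝ≥0∞}
    {P Q : ProbabilityMeasure α} {ε : ℝ} (hQ : Q ∈ ambiguitySet c P ε) {η : ℝ≥0∞} (hη : η ≠ 0) :
    ∃ π ∈ costCouplings c P (ENNReal.ofReal ε + η), π.toMeasure.map Prod.fst = Q.toMeasure := by
  have hlt : OTDiscrepancy c Q.toMeasure P.toMeasure < ENNReal.ofReal ε + η :=
    lt_of_le_of_lt hQ (ENNReal.lt_add_right ENNReal.ofReal_ne_top hη)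
  simp only [OTDiscrepancy, iInf_lt_iff] at hlt
  obtain ⟨π, ⟨h1, h2⟩, hπ⟩ := hlt
  have : IsProbabilityMeasure π := by
    constructor
    have : π.map Prod.fst univ = 1 := by rw [h1]; simp
    rwa [Measure.map_apply measurable_fst MeasurableSet.univ, preimage_univ] at this
  exact ⟨⟨π, this⟩, ⟨h2, hπ.le⟩, h1⟩

theorem isCompact_ambiguitySet {α : Type*} [TopologicalSpace α]
    [TopologicalSpace.MetrizableSpace α] [SecondCountableTopology α] [MeasurableSpace α]
    [BorelSpace α] {c : α → α → ℝ≥0∞} (hc : LowerSemicontinuous fun q : α × α => c q.1 q.2)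
    {P : ProbabilityMeasure α} {ε : ℝ} {W : α → ℝ≥0∞}
    (hWcpt : ∀ R : ℝ≥0∞, R ≠ ⊤ → IsCompact {z | W z ≤ R}) (hW : LowerSemicontinuous W)
    {A : ℝ≥0∞} (hA : A ≠ ⊤) (hWc : ∀ x y, W x ≤ A * (c x y + W y))
    (hWP : ∫⁻ z, W z ∂P.toMeasure ≠ ⊤) : IsCompact (ambiguitySet c P ε) := by
  let T : ProbabilityMeasure (α × α) → ProbabilityMeasure α :=
    fun π => π.map continuous_fst.measurable.aemeasurable
  have hT : Continuous T := ProbabilityMeasure.continuous_map continuous_fst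
  have himg : ∀ n : ℕ,
      IsCompact (T '' costCouplings c P (ENNReal.ofReal ε + ((n : ℝ≥0∞) + 1)⁻¹)) := fun n =>
    (isCompact_costCouplings hc (by simp) hWcpt hW hA hWc hWP).image hT
  have heq : ambiguitySet c P ε =
      ⋂ n : ℕ, T '' costCouplings c P (ENNReal.ofReal ε + ((n : ℝ≥0∞) + 1)⁻¹) := by
    ext Q
    rw [mem_iInter]
    constructor
    · intro hQ n
      obtain ⟨π, hπ, hfst⟩ := exists_mem_costCouplings hQ (η := ((n : ℝ≥0∞) + 1)⁻¹) (by simp)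
      exact ⟨π, hπ, ProbabilityMeasure.toMeasure_injective hfst⟩
    · intro hQ
      have hle : ∀ n : ℕ, OTDiscrepancy c Q.toMeasure P.toMeasure ≤
          ENNReal.ofReal ε + ((n : ℝ≥0∞) + 1)⁻¹ := by
        intro n
        obtain ⟨π, hπ, rfl⟩ := hQ n
        exact (iInf₂_le π.toMeasure ⟨rfl, hπ.1⟩).trans hπ.2
      refine ENNReal.le_of_forall_pos_le_add fun η hη _ => ?_
      obtain ⟨n, hn⟩ := ENNReal.exists_inv_nat_lt (a := (η : ℝ≥0∞)) (by simpa using hη.ne')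
      refine (hle n).trans ?_
      gcongr
      refine le_trans ?_ hn.le
      exact ENNReal.inv_le_inv.2 le_self_add
  rw [heq]
  exact (himg 0).of_isClosed_subset (isClosed_iInter fun n => (himg n).isClosed)
    (iInter_subset _ 0)

theorem lintegral_le_of_mem_ambiguitySet {α : Type*} [MeasurableSpace α]
    {c : α → α → ℝ≥0∞} (hc : Measurable fun q : α × α => c q.1 q.2) {P Q : ProbabilityMeasure α}
    {ε : ℝ} {W : α → ℝ≥0∞} (hW : Measurable W) {A : ℝ≥0∞}
    (hWc : ∀ x y, W x ≤ A * (c x y + W y)) (hQ : Q ∈ ambiguitySet c P ε) :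
    ∫⁻ z, W z ∂Q.toMeasure ≤ A * (ENNReal.ofReal ε + 1 + ∫⁻ z, W z ∂P.toMeasure) := by
  obtain ⟨π, hπ, hfst⟩ := exists_mem_costCouplings hQ one_ne_zero
  rw [← hfst, lintegral_map hW measurable_fst]
  exact lintegral_fst_le_of_mem_costCouplings hc hW hWc hπ

/-- The ambiguity set is convex. -/
theorem exists_mem_ambiguitySet_toMeasure_eq {α : Type*} [MeasurableSpace α] {c : α → α → ℝ≥0∞}
    {P Q₁ Q₂ : ProbabilityMeasure α} {ε : ℝ} (h₁ : Q₁ ∈ ambiguitySet c P ε)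
    (h₂ : Q₂ ∈ ambiguitySet c P ε) {a b : ℝ} (ha : 0 ≤ a) (hb : 0 ≤ b) (hab : a + b = 1) :
    ∃ Q ∈ ambiguitySet c P ε, Q.toMeasure =
      ENNReal.ofReal a • Q₁.toMeasure + ENNReal.ofReal b • Q₂.toMeasure := by
  have hab' : ENNReal.ofReal a + ENNReal.ofReal b = 1 := by
    rw [← ENNReal.ofReal_add ha hb, hab, ENNReal.ofReal_one]
  have hprob : IsProbabilityMeasure
      (ENNReal.ofReal a • Q₁.toMeasure + ENNReal.ofReal b • Q₂.toMeasure) :=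
    ⟨by simp [hab']⟩
  refine ⟨⟨_, hprob⟩, ?_, rfl⟩
  refine ENNReal.le_of_forall_pos_le_add fun η hη _ => ?_
  have hη' : (η : ℝ≥0∞) ≠ 0 := by simpa using hη.ne'
  obtain ⟨π₁, hπ₁, hf₁⟩ := exists_mem_costCouplings h₁ hη'
  obtain ⟨π₂, hπ₂, hf₂⟩ := exists_mem_costCouplings h₂ hη'
  have hmem : ENNReal.ofReal a • π₁.toMeasure + ENNReal.ofReal b • π₂.toMeasure ∈
      couplings (ENNReal.ofReal a • Q₁.toMeasure + ENNReal.ofReal b • Q₂.toMeasure)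
        P.toMeasure := by
    constructor
    · rw [Measure.map_add _ _ measurable_fst, Measure.map_smul, Measure.map_smul, hf₁, hf₂]
    · rw [Measure.map_add _ _ measurable_snd, Measure.map_smul, Measure.map_smul, hπ₁.1, hπ₂.1,
        ← add_smul, hab', one_smul]
  refine (iInf₂_le _ hmem).trans ?_
  rw [lintegral_add_measure, lintegral_smul_measure, lintegral_smul_measure]
  calc _ ≤ ENNReal.ofReal a • (ENNReal.ofReal ε + η) +
        ENNReal.ofReal b • (ENNReal.ofReal ε + η) := by
        gcongr
        exacts [hπ₁.2, hπ₂.2]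
    _ = _ := by rw [← add_smul, hab', one_smul]

theorem integrable_of_lintegral_ofReal_ne_top {Ω : Type*} [MeasurableSpace Ω] {μ : Measure Ω}
    {f : Ω → ℝ} (hf : Measurable f) (hpos : ∫⁻ z, ENNReal.ofReal (f z) ∂μ ≠ ⊤)
    (hneg : ∫⁻ z, ENNReal.ofReal (-f z) ∂μ ≠ ⊤) : Integrable f μ := by
  refine ⟨hf.aestronglyMeasurable, ?_⟩
  have hle : ∫⁻ z, ‖f z‖ₑ ∂μ ≤
      ∫⁻ z, ENNReal.ofReal (f z) ∂μ + ∫⁻ z, ENNReal.ofReal (-f z) ∂μ := by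
    rw [← lintegral_add_left hf.ennreal_ofReal]
    refine lintegral_mono fun z => ?_
    rw [← ofReal_norm, Real.norm_eq_abs]
    rcases abs_cases (f z) with h | h
    · rw [h.1]; exact le_self_add
    · rw [h.1]; exact le_add_self
  exact lt_of_le_of_lt hle (by finiteness)

theorem integral_max_zero_eq_toReal {Ω : Type*} [MeasurableSpace Ω] {μ : Measure Ω} {f : Ω → ℝ}
    (hf : AEStronglyMeasurable f μ) :
    ∫ z, max (f z) 0 ∂μ = (∫⁻ z, ENNReal.ofReal (f z) ∂μ).toReal := by
  have hm : AEStronglyMeasurable (fun z => max (f z) 0) μ := hf.sup aestronglyMeasurable_const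
  have h0 : 0 ≤ᵐ[μ] fun z => max (f z) 0 := ae_of_all _ fun z => le_max_right _ _
  rw [integral_eq_lintegral_of_nonneg_ae h0 hm]
  congr 2 with z
  rw [ENNReal.ofReal_max]
  simp

theorem lintegral_ofReal_ne_top {Ω : Type*} [MeasurableSpace Ω] {μ : Measure Ω} {f : Ω → ℝ}
    (hf : Integrable f μ) : ∫⁻ z, ENNReal.ofReal (f z) ∂μ ≠ ⊤ := by
  refine ne_top_of_le_ne_top hf.2.ne (lintegral_mono fun z => ?_)
  rw [← ofReal_norm]
  exact ENNReal.ofReal_le_ofReal (Real.le_norm_self _)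

/-- The integral of an upper semicontinuous function is upper semicontinuous on a set of
probability measures with respect to which its positive part is uniformly integrable. -/
theorem upperSemicontinuousOn_integral {Ω : Type*} [TopologicalSpace Ω]
    [TopologicalSpace.PseudoMetrizableSpace Ω] [SecondCountableTopology Ω] [MeasurableSpace Ω]
    [BorelSpace Ω] {f : Ω → ℝ} (hf : UpperSemicontinuous f) {B : Set (ProbabilityMeasure Ω)}
    (hfint : ∀ Q ∈ B, Integrable f Q.toMeasure)
    (htail : ∀ η : ℝ, 0 < η → ∃ M : ℝ, ∀ Q ∈ B,
      ∫⁻ z, ENNReal.ofReal (f z - M) ∂Q.toMeasure ≤ ENNReal.ofReal η) :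
    UpperSemicontinuousOn (fun Q : ProbabilityMeasure Ω => ∫ z, f z ∂Q.toMeasure) B := by
  intro Q₀ hQ₀ y (hy : ∫ z, f z ∂Q₀.toMeasure < y)
  set γ := y - ∫ z, f z ∂Q₀.toMeasure with hγdef
  have hγ : 0 < γ := sub_pos.2 hy
  obtain ⟨M₀, hM₀⟩ := htail (γ / 2) (by positivity)
  set M := max M₀ y
  have hid : ∀ Q ∈ B, ∫ z, f z ∂Q.toMeasure =
      M - (∫⁻ z, ENNReal.ofReal (M - f z) ∂Q.toMeasure).toReal +
        (∫⁻ z, ENNReal.ofReal (f z - M) ∂Q.toMeasure).toReal := by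
    intro Q hQ
    have h1 : Integrable (fun z => M - f z) Q.toMeasure := (integrable_const M).sub (hfint Q hQ)
    have h2 : Integrable (fun z => f z - M) Q.toMeasure := (hfint Q hQ).sub (integrable_const M)
    have h1' : Integrable (fun z => max (M - f z) 0) Q.toMeasure := h1.sup (integrable_const 0)
    have h2' : Integrable (fun z => max (f z - M) 0) Q.toMeasure := h2.sup (integrable_const 0)
    rw [← integral_max_zero_eq_toReal h1.1, ← integral_max_zero_eq_toReal h2.1]
    have hpt : ∀ z, f z = M - max (M - f z) 0 + max (f z - M) 0 := fun z => by
      rcases le_total (f z) M with h | h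
      · rw [max_eq_left (sub_nonneg.2 h), max_eq_right (sub_nonpos.2 h)]; ring
      · rw [max_eq_right (sub_nonpos.2 h), max_eq_left (sub_nonneg.2 h)]; ring
    calc ∫ z, f z ∂Q.toMeasure = ∫ z, (M - max (M - f z) 0 + max (f z - M) 0) ∂Q.toMeasure :=
          integral_congr_ae (ae_of_all _ hpt)
      _ = _ := by
          have h3 : Integrable (fun z => M - max (M - f z) 0) Q.toMeasure :=
            (integrable_const M).sub h1'
          rw [integral_add h3 h2', integral_sub (integrable_const M) h1']
          simp
  have hlsc : LowerSemicontinuous fun z => ENNReal.ofReal (M - f z) := by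
    intro z b (hb : b < ENNReal.ofReal (M - f z))
    have hbt : b ≠ ⊤ := ne_top_of_lt hb
    have hb' : b.toReal < M - f z := (ENNReal.lt_ofReal_iff_toReal_lt hbt).1 hb
    filter_upwards [hf z (M - b.toReal) (show f z < _ by linarith)] with z' hz'
    exact (ENNReal.lt_ofReal_iff_toReal_lt hbt).2 (by have : f z' < _ := hz'; linarith)
  have hpos : 0 < M - y + γ / 2 := by linarith [le_max_right M₀ y]
  have hΦ : ENNReal.ofReal (M - y + γ / 2) <
      ∫⁻ z, ENNReal.ofReal (M - f z) ∂Q₀.toMeasure := by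
    have h1 : Integrable (fun z => M - f z) Q₀.toMeasure :=
      (integrable_const M).sub (hfint Q₀ hQ₀)
    rw [ENNReal.ofReal_lt_iff_lt_toReal hpos.le (lintegral_ofReal_ne_top h1)]
    have := hid Q₀ hQ₀
    have h0 : 0 ≤ (∫⁻ z, ENNReal.ofReal (f z - M) ∂Q₀.toMeasure).toReal := ENNReal.toReal_nonneg
    linarith
  filter_upwards [((lowerSemicontinuous_lintegral hlsc).lowerSemicontinuousOn B) Q₀ hQ₀ _ hΦ,
    self_mem_nhdsWithin] with Q hQ hQB
  change ∫ z, f z ∂Q.toMeasure < y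
  have h1 : Integrable (fun z => M - f z) Q.toMeasure := (integrable_const M).sub (hfint Q hQB)
  have hQ' : M - y + γ / 2 < (∫⁻ z, ENNReal.ofReal (M - f z) ∂Q.toMeasure).toReal :=
    (ENNReal.ofReal_lt_iff_lt_toReal hpos.le (lintegral_ofReal_ne_top h1)).1 hQ
  have htl : (∫⁻ z, ENNReal.ofReal (f z - M) ∂Q.toMeasure).toReal ≤ γ / 2 := by
    refine ENNReal.toReal_le_of_le_ofReal (by positivity) (le_trans ?_ (hM₀ Q hQB))
    exact lintegral_mono fun z => ENNReal.ofReal_le_ofReal (by linarith [le_max_left M₀ y])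
  rw [hid Q hQB]
  linarith

/-- The Fatou lemma for a sequence whose negative parts are uniformly integrable. -/
theorem integral_le_of_forall_integral_le {Ω : Type*} [MeasurableSpace Ω] {μ : Measure Ω}
    [IsProbabilityMeasure μ] {f : ℕ → Ω → ℝ} {g : Ω → ℝ} (hfm : ∀ n, Measurable (f n))
    (hf : ∀ n, Integrable (f n) μ) (hg : Integrable g μ)
    (hfg : ∀ z, ∀ y < g z, ∀ᶠ n in atTop, y < f n z)
    (htail : ∀ η : ℝ, 0 < η → ∃ K : ℝ, ∀ᶠ n in atTop,
      ∫⁻ z, ENNReal.ofReal (-f n z - K) ∂μ ≤ ENNReal.ofReal η)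
    {a : ℝ} (ha : ∀ n, ∫ z, f n z ∂μ ≤ a) : ∫ z, g z ∂μ ≤ a := by
  refine le_of_forall_pos_le_add fun η hη => ?_
  obtain ⟨K₀, hK₀⟩ := htail η hη
  set K := max K₀ (-a)
  have haK : 0 ≤ a + K + η := by linarith [le_max_right K₀ (-a)]
  have hbound : ∀ᶠ n in atTop, ∫⁻ z, ENNReal.ofReal (f n z + K) ∂μ ≤
      ENNReal.ofReal (a + K + η) := by
    filter_upwards [hK₀] with n hn
    have h1 : Integrable (fun z => f n z + K) μ := (hf n).add (integrable_const K)
    have h2 : Integrable (fun z => -f n z - K) μ := (hf n).neg.sub (integrable_const K)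
    rw [← ENNReal.toReal_le_toReal (lintegral_ofReal_ne_top h1) ENNReal.ofReal_ne_top,
      ENNReal.toReal_ofReal haK, ← integral_max_zero_eq_toReal h1.1]
    have htl : ∫ z, max (-f n z - K) 0 ∂μ ≤ η := by
      rw [integral_max_zero_eq_toReal h2.1]
      refine ENNReal.toReal_le_of_le_ofReal hη.le (le_trans ?_ hn)
      exact lintegral_mono fun z => ENNReal.ofReal_le_ofReal (by linarith [le_max_left K₀ (-a)])
    have hpt : ∀ z, max (f n z + K) 0 = f n z + K + max (-f n z - K) 0 := fun z => by
      rcases le_total (f n z + K) 0 with h | h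
      · rw [max_eq_right h, max_eq_left (by linarith)]; ring
      · rw [max_eq_left h, max_eq_right (by linarith)]; ring
    have h3 : Integrable (fun z => max (-f n z - K) 0) μ := h2.sup (integrable_const 0)
    rw [integral_congr_ae (ae_of_all _ hpt), integral_add h1 h3,
      integral_add (hf n) (integrable_const K)]
    simp only [integral_const, probReal_univ, one_smul]
    linarith [ha n]
  have hliminf : ∫⁻ z, ENNReal.ofReal (g z + K) ∂μ ≤ ENNReal.ofReal (a + K + η) := by
    calc ∫⁻ z, ENNReal.ofReal (g z + K) ∂μ
        ≤ ∫⁻ z, liminf (fun n => ENNReal.ofReal (f n z + K)) atTop ∂μ := by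
          refine lintegral_mono fun z => le_of_forall_lt fun b hb => ?_
          obtain ⟨b', hb', hb''⟩ := exists_between hb
          refine hb'.trans_le (le_liminf_of_le (by isBoundedDefault) ?_)
          have hbt : b' ≠ ⊤ := ne_top_of_lt hb''
          have hlt := (ENNReal.lt_ofReal_iff_toReal_lt hbt).1 hb''
          filter_upwards [hfg z (b'.toReal - K) (by linarith)] with n hn
          exact ((ENNReal.lt_ofReal_iff_toReal_lt hbt).2 (by linarith)).le
      _ ≤ liminf (fun n => ∫⁻ z, ENNReal.ofReal (f n z + K) ∂μ) atTop :=
          lintegral_liminf_le fun n => ((hfm n).add_const K).ennreal_ofReal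
      _ ≤ ENNReal.ofReal (a + K + η) := liminf_le_of_frequently_le' hbound.frequently
  have hgK : Integrable (fun z => g z + K) μ := hg.add (integrable_const K)
  have h1 : ∫ z, max (g z + K) 0 ∂μ ≤ a + K + η := by
    rw [integral_max_zero_eq_toReal hgK.1]
    exact ENNReal.toReal_le_of_le_ofReal haK hliminf
  have h2 : ∫ z, (g z + K) ∂μ ≤ ∫ z, max (g z + K) 0 ∂μ :=
    integral_mono hgK (hgK.sup (integrable_const 0)) fun z => le_max_left _ _
  rw [integral_add hg (integrable_const K)] at h2
  simp only [integral_const, probReal_univ, one_smul] at h2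
  linarith

/-- A uniform integrability bound controls the integral of the excess over a level. -/
theorem exists_lintegral_ofReal_sub_le {Ω ι : Type*} [MeasurableSpace Ω] {μ : Measure Ω}
    {F : ι → Ω → ℝ≥0∞} (hF : UnifIntegrableENN μ F) {f : ι → Ω → ℝ}
    (hf : ∀ i z, F i z = ENNReal.ofReal (f i z)) (hfm : ∀ i, Measurable (f i))
    {η : ℝ} (hη : 0 < η) :
    ∃ K : ℝ, ∀ i, ∫⁻ z, ENNReal.ofReal (f i z - K) ∂μ ≤ ENNReal.ofReal η := by
  obtain ⟨K, hK⟩ := hF η hη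
  refine ⟨max K 0, fun i => le_trans ?_ (hK i)⟩
  simp only [hf]
  have hms : MeasurableSet {z | ENNReal.ofReal K ≤ ENNReal.ofReal (f i z)} :=
    measurableSet_le measurable_const (hfm i).ennreal_ofReal
  rw [← lintegral_indicator hms]
  refine lintegral_mono fun z => ?_
  rcases le_total (f i z) (max K 0) with h | h
  · simp [ENNReal.ofReal_of_nonpos (sub_nonpos.2 h)]
  · have hmem : z ∈ {z | ENNReal.ofReal K ≤ ENNReal.ofReal (f i z)} :=
      ENNReal.ofReal_le_ofReal ((le_max_left _ _).trans h)
    rw [indicator_of_mem hmem]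
    exact ENNReal.ofReal_le_ofReal (by linarith [le_max_right K 0])

theorem lintegral_ne_top_of_unifIntegrableENN {Ω ι : Type*} [MeasurableSpace Ω] {μ : Measure Ω}
    [IsFiniteMeasure μ] {F : ι → Ω → ℝ≥0∞} (hF : UnifIntegrableENN μ F)
    {f : ι → Ω → ℝ} (hf : ∀ i z, F i z = ENNReal.ofReal (f i z)) (hfm : ∀ i, Measurable (f i))
    (i : ι) : ∫⁻ z, ENNReal.ofReal (f i z) ∂μ ≠ ⊤ := by
  obtain ⟨K, hK⟩ := exists_lintegral_ofReal_sub_le hF hf hfm one_pos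
  have hle : ∫⁻ z, ENNReal.ofReal (f i z) ∂μ ≤
      ∫⁻ z, (ENNReal.ofReal (f i z - K) + ENNReal.ofReal K) ∂μ :=
    lintegral_mono fun z => by
      calc ENNReal.ofReal (f i z) = ENNReal.ofReal (f i z - K + K) := by simp
        _ ≤ _ := ENNReal.ofReal_add_le
  refine ne_top_of_le_ne_top ?_ hle
  rw [lintegral_add_right _ measurable_const, lintegral_const]
  have := ne_top_of_le_ne_top ENNReal.ofReal_ne_top (hK i)
  finiteness

theorem erealPos_coe (x : ℝ) : erealPos (x : EReal) = ENNReal.ofReal x := by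
  simp [erealPos]

theorem eint_coe_eq_integral {Ω : Type*} [MeasurableSpace Ω] {μ : Measure Ω} {f : Ω → ℝ}
    (hf : Integrable f μ) : eint μ (fun z => (f z : EReal)) = ((∫ z, f z ∂μ : ℝ) : EReal) := by
  have hneg : ∫⁻ z, ENNReal.ofReal (-f z) ∂μ ≠ ⊤ := lintegral_ofReal_ne_top hf.neg
  simp only [eint, ← EReal.coe_neg, erealPos_coe]
  rw [integral_eq_lintegral_pos_part_sub_lintegral_neg_part hf, EReal.coe_sub,
    EReal.coe_ennreal_toReal (lintegral_ofReal_ne_top hf),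
    EReal.coe_ennreal_toReal hneg]

/-- A power is dominated by any multiple of a higher power up to an additive constant. -/
theorem exists_rpow_le_add_mul_pow {r : ℝ} {p : ℕ} (hr : 0 < r) (hrp : r < p) {η : ℝ}
    (hη : 0 < η) : ∃ M : ℝ, ∀ t : ℝ, 0 ≤ t → t ^ r ≤ M + η * t ^ p := by
  set T := η ^ (1 / (r - p)) with hTdef
  have hT : 0 < T := Real.rpow_pos_of_pos hη _
  have hTη : T ^ (r - p) = η := by
    rw [hTdef, ← Real.rpow_mul hη.le, one_div_mul_cancel (by linarith), Real.rpow_one]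
  refine ⟨T ^ r, fun t ht => ?_⟩
  rcases le_total t T with h | h
  · have := Real.rpow_le_rpow ht h hr.le
    have : 0 ≤ η * t ^ p := by positivity
    linarith
  · have ht' : 0 < t := hT.trans_le h
    have h1 : t ^ (r - p) ≤ η := by
      rw [← hTη]
      exact Real.rpow_le_rpow_of_nonpos hT h (by linarith)
    have h2 : t ^ r = t ^ (r - p) * t ^ p := by
      rw [← Real.rpow_natCast, ← Real.rpow_add ht']; simp
    have h3 : 0 ≤ T ^ r := by positivity
    have h4 : t ^ (r - p) * t ^ p ≤ η * t ^ p := by gcongr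
    linarith

/-- A minimax theorem for an extended real valued function that is finite on `X × B`, with
attainment of both optimal values. -/
theorem biInf_biSup_eq_biSup_biInf_and_attained {E Y : Type*} [AddCommGroup E] [Module ℝ E]
    [TopologicalSpace E] [TopologicalSpace Y] {X : Set E} (hX : Convex ℝ X) (hXne : X.Nonempty)
    {B : Set Y} (hB : IsCompact B) (G : E → Y → EReal) (F : E → Y → ℝ)
    (hG : ∀ x ∈ X, ∀ y ∈ B, G x y = (F x y : EReal))
    (hconv : ∀ y ∈ B, ConvexOn ℝ X (fun x => F x y))
    (husc : ∀ x ∈ X, UpperSemicontinuousOn (F x) B)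
    (haff : ∀ y₁ ∈ B, ∀ y₂ ∈ B, ∀ a b : ℝ, 0 ≤ a → 0 ≤ b → a + b = 1 →
      ∃ y ∈ B, ∀ x ∈ X, F x y = a * F x y₁ + b * F x y₂)
    (hclosed : ∀ y ∈ B, ∀ a : ℝ, IsClosed {x | x ∈ X ∧ G x y ≤ (a : EReal)})
    (hcpt : ∃ y ∈ B, ∀ a : ℝ, IsCompact {x | x ∈ X ∧ G x y ≤ (a : EReal)}) :
    (⨅ x ∈ X, ⨆ y ∈ B, G x y) = (⨆ y ∈ B, ⨅ x ∈ X, G x y) ∧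
    (∃ x₀ ∈ X, (⨆ y ∈ B, G x₀ y) = ⨅ x ∈ X, ⨆ y ∈ B, G x y) ∧
    (∃ y₀ ∈ B, (⨅ x ∈ X, G x y₀) = ⨆ y ∈ B, ⨅ x ∈ X, G x y) := by
  obtain ⟨yc, hyc, hcpt⟩ := hcpt
  refine ⟨le_antisymm ?_ ?_, ?_, ?_⟩
  · by_contra! hlt
    obtain ⟨s, hs₁, hs₂⟩ := EReal.lt_iff_exists_real_btwn.1 hlt
    obtain ⟨x, hx, hxs⟩ := exists_forall_le_of_forall_exists_lt hX hB ⟨yc, hyc⟩ F hconv husc haff s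
      (fun y hy => by
        have h1 : (⨅ x ∈ X, G x y) < (s : EReal) :=
          (le_iSup₂ (f := fun y (_ : y ∈ B) => ⨅ x ∈ X, G x y) y hy).trans_lt hs₁
        simp only [iInf_lt_iff] at h1
        obtain ⟨x, hx, hlt⟩ := h1
        exact ⟨x, hx, by rw [hG x hx y hy] at hlt; exact_mod_cast hlt⟩)
    have h2 : (⨅ x ∈ X, ⨆ y ∈ B, G x y) ≤ (s : EReal) :=
      (iInf₂_le x hx).trans (iSup₂_le fun y hy => by
        rw [hG x hx y hy]; exact_mod_cast hxs y hy)
    exact absurd hs₂ (not_lt.2 h2)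
  · exact iSup₂_le fun y hy => le_iInf₂ fun x hx =>
      (iInf₂_le x hx).trans (le_iSup₂ (f := fun y (_ : y ∈ B) => G x y) y hy)
  · set φ : E → EReal := fun x => ⨆ y ∈ B, G x y
    have hφclosed : ∀ a : ℝ, IsClosed {x | x ∈ X ∧ φ x ≤ (a : EReal)} := by
      intro a
      have heq : {x | x ∈ X ∧ φ x ≤ (a : EReal)} =
          ⋂ y ∈ B, {x | x ∈ X ∧ G x y ≤ (a : EReal)} := by
        ext x
        simp only [mem_ofPred_eq, mem_iInter, φ, iSup_le_iff]
        exact ⟨fun h y hy => ⟨h.1, h.2 y hy⟩, fun h => ⟨(h yc hyc).1, fun y hy => (h y hy).2⟩⟩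
      rw [heq]
      exact isClosed_biInter fun y hy => hclosed y hy a
    have hφ : LowerSemicontinuousOn φ X := by
      intro x hx t (ht : t < φ x)
      obtain ⟨b, hb₁, hb₂⟩ := EReal.lt_iff_exists_real_btwn.1 ht
      filter_upwards [self_mem_nhdsWithin, mem_nhdsWithin_of_mem_nhds
        ((hφclosed b).isOpen_compl.mem_nhds fun h => absurd h.2 (not_le.2 hb₂))] with x' hx' hb'
      have : ¬ φ x' ≤ (b : EReal) := fun h => hb' ⟨hx', h⟩
      exact hb₁.trans (not_le.1 this)
    rcases eq_or_ne (⨅ x ∈ X, φ x) ⊤ with htop | htop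
    · obtain ⟨x, hx⟩ := hXne
      exact ⟨x, hx, le_antisymm (htop ▸ le_top) (iInf₂_le x hx)⟩
    · have h1 := lt_top_iff_ne_top.2 htop
      simp only [iInf_lt_iff] at h1
      obtain ⟨x₀, hx₀, h1⟩ := h1
      obtain ⟨a, ha, -⟩ := EReal.lt_iff_exists_real_btwn.1 h1
      have hle : ∀ x, G x yc ≤ φ x := fun x => le_iSup₂ (f := fun y (_ : y ∈ B) => G x y) yc hyc
      obtain ⟨x₁, hx₁, hmin⟩ := (hφ.mono fun x hx => hx.1).exists_isMinOn
        (s := {x | x ∈ X ∧ G x yc ≤ (a : EReal)}) ⟨x₀, hx₀, (hle x₀).trans ha.le⟩ (hcpt a)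
      refine ⟨x₁, hx₁.1, le_antisymm (le_iInf₂ fun x hx => ?_) (iInf₂_le x₁ hx₁.1)⟩
      rcases le_total (G x yc) a with h | h
      · exact hmin ⟨hx, h⟩
      · exact (hmin ⟨hx₀, (hle x₀).trans ha.le⟩).trans (ha.le.trans (h.trans (hle x)))
  · have hψ : UpperSemicontinuousOn (fun y => ⨅ x ∈ X, G x y) B := by
      refine upperSemicontinuousOn_biInf fun x hx => ?_
      intro y hy t (ht : G x y < t)
      rw [hG x hx y hy] at ht
      obtain ⟨b, hb₁, hb₂⟩ := EReal.lt_iff_exists_real_btwn.1 ht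
      filter_upwards [self_mem_nhdsWithin, husc x hx y hy b (EReal.coe_lt_coe_iff.1 hb₁)]
        with y' hy' hb'
      change G x y' < t
      rw [hG x hx y' hy']
      exact (EReal.coe_lt_coe_iff.2 hb').trans hb₂
    obtain ⟨y₀, hy₀, hmax⟩ := hψ.exists_isMaxOn ⟨yc, hyc⟩ hB
    exact ⟨y₀, hy₀, le_antisymm (le_iSup₂ (f := fun y (_ : y ∈ B) => ⨅ x ∈ X, G x y) y₀ hy₀)
      (iSup₂_le fun y hy => hmax hy)⟩

theorem nonneg_of_symm_of_triangle {α : Type*} {δ : α → α → ℝ} (hid : ∀ x y, δ x y = 0 ↔ x = y)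
    (hsymm : ∀ x y, δ x y = δ y x) (htri : ∀ x y z, δ x z ≤ δ x y + δ y z) (x y : α) :
    0 ≤ δ x y := by
  have h := htri x y x
  rw [(hid x x).2 rfl, hsymm y x] at h
  linarith

theorem pow_le_mul_add_of_triangle {α : Type*} {δ : α → α → ℝ} (hδ : ∀ x y, 0 ≤ δ x y)
    (htri : ∀ x y z, δ x z ≤ δ x y + δ y z) (p : ℕ) (x y z : α) :
    δ x z ^ p ≤ 2 ^ (p - 1) * (δ x y ^ p + δ y z ^ p) :=
  (pow_le_pow_left₀ (hδ x z) (htri x y z) p).trans (add_pow_le (hδ x y) (hδ y z) p)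

theorem isCompact_setOf_ofReal_pow_le {α : Type*} [TopologicalSpace α] {f : α → ℝ}
    (hf : ∀ z, 0 ≤ f z) (hcpt : ∀ r : ℝ, IsCompact {z | f z ≤ r}) {p : ℕ} (hp : p ≠ 0)
    {R : ℝ≥0∞} (hR : R ≠ ⊤) : IsCompact {z | ENNReal.ofReal (f z ^ p) ≤ R} := by
  have heq : {z | ENNReal.ofReal (f z ^ p) ≤ R} = {z | f z ≤ R.toReal ^ (1 / p : ℝ)} := by
    ext z
    have hroot : (R.toReal ^ (1 / p : ℝ)) ^ p = R.toReal := by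
      rw [one_div, Real.rpow_inv_natCast_pow ENNReal.toReal_nonneg hp]
    simp only [mem_ofPred_eq]
    rw [ENNReal.ofReal_le_iff_le_toReal hR, ← hroot]
    rw [pow_le_pow_iff_left₀ (hf z) (by positivity) hp, hroot]
  rw [heq]
  exact hcpt _

theorem lowerSemicontinuous_of_isCompact_setOf_le {α : Type*} [TopologicalSpace α] [T2Space α]
    {W : α → ℝ≥0∞} (hcpt : ∀ R : ℝ≥0∞, R ≠ ⊤ → IsCompact {z | W z ≤ R}) :
    LowerSemicontinuous W := by
  rw [lowerSemicontinuous_iff_isClosed_preimage]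
  intro R
  rcases eq_or_ne R ⊤ with rfl | hR
  · simp
  · exact (hcpt R hR).isClosed

/-- A function of growth order `r < p` is dominated by any multiple of the `p`-th power of the
distance to a reference point, up to an additive constant. -/
theorem exists_le_add_mul_pow_of_growth {α : Type*} {δ : α → α → ℝ} (hδ : ∀ x y, 0 ≤ δ x y)
    (htri : ∀ x y z, δ x z ≤ δ x y + δ y z) {p : ℕ} {r g : ℝ} (hr : 0 < r) (hrp : r < p)
    (hg : 0 < g) {f : α → ℝ} {z₁ : α} (hf : ∀ z, f z ≤ g * (1 + δ z z₁ ^ r)) (z₀ : α) {η : ℝ}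
    (hη : 0 < η) : ∃ M : ℝ, ∀ z, f z ≤ M + η * δ z z₀ ^ p := by
  have hA : (0 : ℝ) < g * 2 ^ (p - 1) := by positivity
  obtain ⟨M, hM⟩ := exists_rpow_le_add_mul_pow hr hrp (div_pos hη hA)
  refine ⟨g * (1 + M) + η * δ z₀ z₁ ^ p, fun z => ?_⟩
  calc f z ≤ g * (1 + δ z z₁ ^ r) := hf z
    _ ≤ g * (1 + (M + η / (g * 2 ^ (p - 1)) * δ z z₁ ^ p)) := by
        gcongr
        exact hM _ (hδ z z₁)
    _ ≤ g * (1 + (M + η / (g * 2 ^ (p - 1)) *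
          (2 ^ (p - 1) * (δ z z₀ ^ p + δ z₀ z₁ ^ p)))) := by
        gcongr
        exact pow_le_mul_add_of_triangle hδ htri p z z₀ z₁
    _ = g * (1 + M) + η * δ z₀ z₁ ^ p + η * δ z z₀ ^ p := by
        field_simp
        ring

theorem exists_lintegral_ofReal_sub_le_of_le_add_mul {Ω : Type*} [MeasurableSpace Ω]
    {f w : Ω → ℝ} (hf : ∀ η : ℝ, 0 < η → ∃ M : ℝ, ∀ z, f z ≤ M + η * w z) {K : ℝ≥0∞}
    (hK : K ≠ ⊤) {η : ℝ} (hη : 0 < η) :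
    ∃ M : ℝ, ∀ μ : Measure Ω, ∫⁻ z, ENNReal.ofReal (w z) ∂μ ≤ K →
      ∫⁻ z, ENNReal.ofReal (f z - M) ∂μ ≤ ENNReal.ofReal η := by
  have hK' : 0 ≤ K.toReal := ENNReal.toReal_nonneg
  have hη' : 0 < η / (K.toReal + 1) := by positivity
  obtain ⟨M, hM⟩ := hf _ hη'
  refine ⟨M, fun μ hμ => ?_⟩
  calc ∫⁻ z, ENNReal.ofReal (f z - M) ∂μ
      ≤ ∫⁻ z, ENNReal.ofReal (η / (K.toReal + 1)) * ENNReal.ofReal (w z) ∂μ := by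
        refine lintegral_mono fun z => ?_
        rw [← ENNReal.ofReal_mul hη'.le]
        exact ENNReal.ofReal_le_ofReal (by linarith [hM z])
    _ = ENNReal.ofReal (η / (K.toReal + 1)) * ∫⁻ z, ENNReal.ofReal (w z) ∂μ :=
        lintegral_const_mul' _ _ ENNReal.ofReal_ne_top
    _ ≤ ENNReal.ofReal (η / (K.toReal + 1)) * ENNReal.ofReal K.toReal := by
        rw [ENNReal.ofReal_toReal hK]
        gcongr
    _ ≤ ENNReal.ofReal η := by
        rw [← ENNReal.ofReal_mul hη'.le]
        refine ENNReal.ofReal_le_ofReal ?_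
        rw [div_mul_eq_mul_div, div_le_iff₀ (by positivity)]
        nlinarith

theorem isClosed_setOf_integral_le {E Ω : Type*} [TopologicalSpace E] [FirstCountableTopology E]
    [MeasurableSpace Ω] {μ : Measure Ω} [IsProbabilityMeasure μ] {X : Set E} (hX : IsClosed X)
    {f : E → Ω → ℝ} (hfm : ∀ x ∈ X, Measurable (f x)) (hf : ∀ x ∈ X, Integrable (f x) μ)
    (hlsc : ∀ z, LowerSemicontinuousOn (fun x => f x z) X)
    (htail : ∀ x ∈ X, ∃ U ∈ 𝓝[X] x, ∀ η : ℝ, 0 < η → ∃ K : ℝ, ∀ x' ∈ U ∩ X,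
      ∫⁻ z, ENNReal.ofReal (-f x' z - K) ∂μ ≤ ENNReal.ofReal η) (a : ℝ) :
    IsClosed {x | x ∈ X ∧ ∫ z, f x z ∂μ ≤ a} := by
  refine IsSeqClosed.isClosed fun u x hu hx => ?_
  have hxX : x ∈ X := hX.mem_of_tendsto hx (Eventually.of_forall fun n => (hu n).1)
  have hxw : Tendsto u atTop (𝓝[X] x) :=
    tendsto_nhdsWithin_iff.2 ⟨hx, Eventually.of_forall fun n => (hu n).1⟩
  obtain ⟨U, hU, hUK⟩ := htail x hxX
  refine ⟨hxX, integral_le_of_forall_integral_le (fun n => hfm _ (hu n).1)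
    (fun n => hf _ (hu n).1) (hf x hxX) (fun z y hy => hxw.eventually (hlsc z x hxX y hy))
    (fun η hη => ?_) fun n => (hu n).2⟩
  obtain ⟨K, hK⟩ := hUK η hη
  refine ⟨K, ?_⟩
  filter_upwards [hxw.eventually hU] with n hn
  exact hK _ ⟨hn, (hu n).1⟩

/-- **Minimax theorem, part (iii).**
Under all assumptions of parts (i) and (ii), the primal and dual DRO problems share the
same optimal value and both the infimum over `θ` and the supremum over `Q` are attained. -/
theorem minimax_both_attained {d m : ℕ}
    (𝒵 : Set (Fin d → ℝ)) (h𝒵closed : IsClosed 𝒵) (h𝒵ne : 𝒵.Nonempty)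
    (Θ : Set (Fin m → ℝ)) (hΘclosed : IsClosed Θ) (hΘne : Θ.Nonempty)
    (hΘconv : Convex ℝ Θ)
    (c : 𝒵 → 𝒵 → ℝ≥0∞) (hc_id : ∀ z zhat : 𝒵, c z zhat = 0 ↔ z = zhat)
    (Phat : ProbabilityMeasure 𝒵)
    (ℓ : (Fin m → ℝ) → 𝒵 → EReal) (hℓbot : ∀ θ z, ℓ θ z ≠ ⊥)
    (hℓconv : ∀ z : 𝒵, ∀ θ₁ ∈ Θ, ∀ θ₂ ∈ Θ, ∀ a b : ℝ, 0 ≤ a → 0 ≤ b → a + b = 1 →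
      ℓ (a • θ₁ + b • θ₂) z ≤ (a : EReal) * ℓ θ₁ z + (b : EReal) * ℓ θ₂ z)
    (ε : ℝ) (hε : 0 ≤ ε)
    -- the cost is lower semicontinuous
    (hc_lsc : LowerSemicontinuous (fun q : 𝒵 × 𝒵 => c q.1 q.2))
    -- the loss is upper semicontinuous and `P̂`-integrable in `z`
    (h_usc : ∀ θ ∈ Θ, UpperSemicontinuous (fun z : 𝒵 => ℓ θ z))
    (h_int : ∀ θ ∈ Θ, (∫⁻ z, erealPos (ℓ θ z) ∂Phat.toMeasure) ≠ ⊤ ∧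
      (∫⁻ z, erealPos (-(ℓ θ z)) ∂Phat.toMeasure) ≠ ⊤)
    -- moment bound at a reference point
    (zhat₀ : 𝒵) (C : ℝ) (hC : ∫⁻ z, c z zhat₀ ∂Phat.toMeasure ≤ ENNReal.ofReal C)
    -- a metric with compact sublevel sets dominated by the cost
    (δ : 𝒵 → 𝒵 → ℝ)
    (hδ_id : ∀ z zhat : 𝒵, δ z zhat = 0 ↔ z = zhat)
    (hδ_symm : ∀ z zhat : 𝒵, δ z zhat = δ zhat z)
    (hδ_tri : ∀ x y z : 𝒵, δ x z ≤ δ x y + δ y z)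
    (hδ_cpt : ∀ (zhat : 𝒵) (r : ℝ), IsCompact {z : 𝒵 | δ z zhat ≤ r})
    (p : ℕ) (hp : 1 ≤ p)
    (hcδ : ∀ z zhat : 𝒵, ENNReal.ofReal (δ z zhat ^ p) ≤ c z zhat)
    -- lower semicontinuity of the loss in `θ`
    (h_lsc : ∀ z : 𝒵, LowerSemicontinuousOn (fun θ => ℓ θ z) Θ)
    -- local uniform integrability of the negative parts
    (h_ui : ∀ Q ∈ ambiguitySet c Phat ε, ∀ θbar ∈ Θ, ∃ U ∈ 𝓝[Θ] θbar,
      UnifIntegrableENN Q.toMeasure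
        (fun (θ : ↥(U ∩ Θ)) (z : 𝒵) => erealPos (-(ℓ (θ : Fin m → ℝ) z))))
    -- inf-compactness of the expected loss for some `Q` in the ambiguity set
    (h_infcpt : ∃ Q ∈ ambiguitySet c Phat ε, ∀ a : ℝ,
      IsCompact {θ | θ ∈ Θ ∧ eint Q.toMeasure (ℓ θ) ≤ (a : EReal)})
    -- growth condition of order `r < p` on the loss
    (h_growth : ∀ θ ∈ Θ, ∃ g : ℝ, 0 < g ∧ ∃ zhat₁ : 𝒵, ∃ r : ℝ, 0 < r ∧ r < (p : ℝ) ∧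
      ∀ z : 𝒵, ℓ θ z ≤ ((g * (1 + δ z zhat₁ ^ r) : ℝ) : EReal))
    -- properness of the primal problem
    (h_proper₁ : ∃ θ ∈ Θ,
      (⨆ Q ∈ ambiguitySet c Phat ε, eint Q.toMeasure (ℓ θ)) < ⊤)
    -- properness of the dual problem
    (h_proper₂ : ∃ Q ∈ ambiguitySet c Phat ε,
      ⊥ < (⨅ θ ∈ Θ, eint Q.toMeasure (ℓ θ))) :
    (⨅ θ ∈ Θ, ⨆ Q ∈ ambiguitySet c Phat ε, eint Q.toMeasure (ℓ θ)) =
      (⨆ Q ∈ ambiguitySet c Phat ε, ⨅ θ ∈ Θ, eint Q.toMeasure (ℓ θ)) ∧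
    (∃ θstar ∈ Θ,
      (⨆ Q ∈ ambiguitySet c Phat ε, eint Q.toMeasure (ℓ θstar)) =
        (⨅ θ ∈ Θ, ⨆ Q ∈ ambiguitySet c Phat ε, eint Q.toMeasure (ℓ θ))) ∧
    (∃ Qstar ∈ ambiguitySet c Phat ε,
      (⨅ θ ∈ Θ, eint Qstar.toMeasure (ℓ θ)) =
        (⨆ Q ∈ ambiguitySet c Phat ε, ⨅ θ ∈ Θ, eint Q.toMeasure (ℓ θ))) := by
  have hδ0 : ∀ x y, 0 ≤ δ x y := nonneg_of_symm_of_triangle hδ_id hδ_symm hδ_tri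
  set W : 𝒵 → ℝ≥0∞ := fun z => ENNReal.ofReal (δ z zhat₀ ^ p) with hWdef
  have hWcpt : ∀ R : ℝ≥0∞, R ≠ ⊤ → IsCompact {z | W z ≤ R} := fun R hR =>
    isCompact_setOf_ofReal_pow_le (fun z => hδ0 z zhat₀) (hδ_cpt zhat₀) (by omega) hR
  have hW : LowerSemicontinuous W := lowerSemicontinuous_of_isCompact_setOf_le hWcpt
  have hWc : ∀ x y, W x ≤ ENNReal.ofReal (2 ^ (p - 1)) * (c x y + W y) := fun x y => by
    calc W x ≤ ENNReal.ofReal (2 ^ (p - 1) * (δ x y ^ p + δ y zhat₀ ^ p)) :=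
          ENNReal.ofReal_le_ofReal (pow_le_mul_add_of_triangle hδ0 hδ_tri p x y zhat₀)
      _ = ENNReal.ofReal (2 ^ (p - 1)) * (ENNReal.ofReal (δ x y ^ p) + W y) := by
          rw [ENNReal.ofReal_mul (by positivity),
            ENNReal.ofReal_add (pow_nonneg (hδ0 _ _) p) (pow_nonneg (hδ0 _ _) p)]
      _ ≤ _ := by
          gcongr
          exact hcδ x y
  have hWP : ∫⁻ z, W z ∂Phat.toMeasure ≠ ⊤ :=
    ne_top_of_le_ne_top ENNReal.ofReal_ne_top
      ((lintegral_mono fun z => hcδ z zhat₀).trans hC)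
  set B := ambiguitySet c Phat ε
  have hB : IsCompact B :=
    isCompact_ambiguitySet hc_lsc hWcpt hW ENNReal.ofReal_ne_top hWc hWP
  obtain ⟨K, hK, hWK⟩ : ∃ K : ℝ≥0∞, K ≠ ⊤ ∧ ∀ Q ∈ B, ∫⁻ z, W z ∂Q.toMeasure ≤ K :=
    ⟨_, by finiteness, fun Q hQ =>
      lintegral_le_of_mem_ambiguitySet hc_lsc.measurable hW.measurable hWc hQ⟩
  set L : (Fin m → ℝ) → 𝒵 → ℝ := fun θ z => (ℓ θ z).toReal with hLdef
  have hL : ∀ θ ∈ Θ, ∀ z, ℓ θ z = (L θ z : EReal) := fun θ hθ z => by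
    obtain ⟨g, -, z₁, r, -, -, hgr⟩ := h_growth θ hθ
    exact (EReal.coe_toReal (ne_top_of_le_ne_top (EReal.coe_ne_top _) (hgr z)) (hℓbot θ z)).symm
  have hLusc : ∀ θ ∈ Θ, UpperSemicontinuous (L θ) := fun θ hθ z y (hy : L θ z < y) => by
    have hy' : ℓ θ z < (y : EReal) := by rw [hL θ hθ z]; exact_mod_cast hy
    filter_upwards [h_usc θ hθ z y hy'] with z' hz'
    have hz'' : ℓ θ z' < (y : EReal) := hz'
    rw [hL θ hθ z'] at hz''
    exact EReal.coe_lt_coe_iff.1 hz''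
  have hLm : ∀ θ ∈ Θ, Measurable (L θ) := fun θ hθ => (hLusc θ hθ).measurable
  have hLgrowth : ∀ θ ∈ Θ, ∀ η : ℝ, 0 < η → ∃ M : ℝ, ∀ z, L θ z ≤ M + η * δ z zhat₀ ^ p :=
    fun θ hθ η hη => by
      obtain ⟨g, hg, z₁, r, hr, hrp, hgr⟩ := h_growth θ hθ
      refine exists_le_add_mul_pow_of_growth hδ0 hδ_tri hr hrp hg (z₁ := z₁) (fun z => ?_) zhat₀ hη
      have := hgr z
      rw [hL θ hθ z] at this
      exact EReal.coe_le_coe_iff.1 this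
  have hLtail : ∀ θ ∈ Θ, ∀ η : ℝ, 0 < η → ∃ M : ℝ, ∀ Q ∈ B,
      ∫⁻ z, ENNReal.ofReal (L θ z - M) ∂Q.toMeasure ≤ ENNReal.ofReal η := fun θ hθ η hη => by
    obtain ⟨M, hM⟩ := exists_lintegral_ofReal_sub_le_of_le_add_mul (hLgrowth θ hθ) hK hη
    exact ⟨M, fun Q hQ => hM _ (hWK Q hQ)⟩
  have hneg : ∀ U : Set (Fin m → ℝ), ∀ (i : ↥(U ∩ Θ)) (z : 𝒵),
      erealPos (-(ℓ (i : Fin m → ℝ) z)) = ENNReal.ofReal (-L i z) := fun U i z => by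
    rw [hL i i.2.2 z, ← EReal.coe_neg, erealPos_coe]
  have hLint : ∀ Q ∈ B, ∀ θ ∈ Θ, Integrable (L θ) Q.toMeasure := fun Q hQ θ hθ => by
    refine integrable_of_lintegral_ofReal_ne_top (hLm θ hθ) ?_ ?_
    · obtain ⟨M, hM⟩ := hLgrowth θ hθ 1 one_pos
      have hle : ∫⁻ z, ENNReal.ofReal (L θ z) ∂Q.toMeasure ≤
          ∫⁻ z, (ENNReal.ofReal M + W z) ∂Q.toMeasure := lintegral_mono fun z =>
        (ENNReal.ofReal_le_ofReal (by simpa using hM z)).trans ENNReal.ofReal_add_le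
      refine ne_top_of_le_ne_top ?_ hle
      rw [lintegral_add_left measurable_const, lintegral_const]
      have := ne_top_of_le_ne_top hK (hWK Q hQ)
      finiteness
    · obtain ⟨U, hU, hUI⟩ := h_ui Q hQ θ hθ
      exact lintegral_ne_top_of_unifIntegrableENN hUI (f := fun i z => -L i z) (hneg U)
        (fun i => (hLm i i.2.2).neg) ⟨θ, mem_of_mem_nhdsWithin hθ hU, hθ⟩
  have hG : ∀ θ ∈ Θ, ∀ Q ∈ B, eint Q.toMeasure (ℓ θ) =
      ((∫ z, L θ z ∂Q.toMeasure : ℝ) : EReal) := fun θ hθ Q hQ => by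
    rw [← eint_coe_eq_integral (hLint Q hQ θ hθ)]
    congr 1
    exact funext (hL θ hθ)
  have hLlsc : ∀ z, LowerSemicontinuousOn (fun θ => L θ z) Θ := fun z θ hθ y (hy : y < L θ z) => by
    have hy' : (y : EReal) < ℓ θ z := by rw [hL θ hθ z]; exact_mod_cast hy
    filter_upwards [h_lsc z θ hθ y hy', self_mem_nhdsWithin] with θ' hθ' hθ'Θ
    have hlt : (y : EReal) < ℓ θ' z := hθ'
    rw [hL θ' hθ'Θ z] at hlt
    exact EReal.coe_lt_coe_iff.1 hlt
  refine biInf_biSup_eq_biSup_biInf_and_attained hΘconv hΘne hB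
    (fun θ (Q : ProbabilityMeasure 𝒵) => eint Q.toMeasure (ℓ θ))
    (fun θ Q => ∫ z, L θ z ∂Q.toMeasure) hG (fun Q hQ => ⟨hΘconv, ?_⟩)
    (fun θ hθ => upperSemicontinuousOn_integral (hLusc θ hθ) (fun Q hQ => hLint Q hQ θ hθ)
      (hLtail θ hθ)) ?_ ?_ h_infcpt
  · intro θ₁ h₁ θ₂ h₂ a b ha hb hab
    have hi₁ := (hLint Q hQ θ₁ h₁).const_mul a
    have hi₂ := (hLint Q hQ θ₂ h₂).const_mul b
    have hmem := hΘconv h₁ h₂ ha hb hab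
    calc ∫ z, L (a • θ₁ + b • θ₂) z ∂Q.toMeasure
        ≤ ∫ z, (a * L θ₁ z + b * L θ₂ z) ∂Q.toMeasure := by
          refine integral_mono (hLint Q hQ _ hmem) (hi₁.add hi₂) fun z => ?_
          have := hℓconv z θ₁ h₁ θ₂ h₂ a b ha hb hab
          rw [hL _ hmem z, hL _ h₁ z, hL _ h₂ z] at this
          exact_mod_cast this
      _ = _ := by
          rw [integral_add hi₁ hi₂, integral_const_mul, integral_const_mul]
          simp
  · intro Q₁ h₁ Q₂ h₂ a b ha hb hab
    obtain ⟨Q, hQ, hQeq⟩ := exists_mem_ambiguitySet_toMeasure_eq h₁ h₂ ha hb hab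
    refine ⟨Q, hQ, fun θ hθ => ?_⟩
    have hi₁ := (hLint Q₁ h₁ θ hθ).smul_measure (ENNReal.ofReal_ne_top (r := a))
    have hi₂ := (hLint Q₂ h₂ θ hθ).smul_measure (ENNReal.ofReal_ne_top (r := b))
    simp only [hQeq]
    rw [integral_add_measure hi₁ hi₂, integral_smul_measure, integral_smul_measure,
      ENNReal.toReal_ofReal ha, ENNReal.toReal_ofReal hb, smul_eq_mul, smul_eq_mul]
  · intro Q hQ a
    have heq : {θ | θ ∈ Θ ∧ eint Q.toMeasure (ℓ θ) ≤ (a : EReal)} =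
        {θ | θ ∈ Θ ∧ ∫ z, L θ z ∂Q.toMeasure ≤ a} := by
      ext θ
      refine and_congr_right fun hθ => ?_
      rw [hG θ hθ Q hQ, EReal.coe_le_coe_iff]
    rw [heq]
    refine isClosed_setOf_integral_le hΘclosed hLm (hLint Q hQ) hLlsc (fun θ hθ => ?_) a
    obtain ⟨U, hU, hUI⟩ := h_ui Q hQ θ hθ
    refine ⟨U, hU, fun η hη => ?_⟩
    obtain ⟨K', hK'⟩ := exists_lintegral_ofReal_sub_le hUI (f := fun i z => -L i z) (hneg U)
      (fun i => (hLm i i.2.2).neg) hη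
    exact ⟨K', fun θ' hθ' => hK' ⟨θ', hθ'⟩⟩
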